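/- arXiv:2207.04127 — 2 statements merged into one kernel-verified Lean document; each statement's English description precedes it below -/
import Mathlib

section
/- Let c : [0,1]^2 → ℝ be a nonnegative Lebesgue-integrable function satisfying (i) c(u,v) = c(1−u, 1−v) for almost every (u,v) ∈ [0,1]^2 (radial symmetry), and (ii) c(u,v) > c(u, 1−v) for almost every (u,v) ∈ (0, 1/2) × (0, 1/2). Then ∫_{[0,1]^2} 1{c(u,v) > c(u,1−v)}·c(u,v) du dv = 2·∫_{[0,1/2]×[0,1/2]} c(u,v) du dv. -/
open MeasureTheory

/-- Reflection of the second coordinate preserves Lebesgue measure on the plane. -/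
lemma measurePreserving_reflect_snd :
    MeasurePreserving (fun p : ℝ × ℝ => (p.1, 1 - p.2)) volume volume :=
  (MeasurePreserving.id volume).prod (Measure.measurePreserving_sub_left volume (1 : ℝ))

/-- Reflection of the first coordinate preserves Lebesgue measure on the plane. -/
lemma measurePreserving_reflect_fst :
    MeasurePreserving (fun p : ℝ × ℝ => (1 - p.1, p.2)) volume volume :=
  (Measure.measurePreserving_sub_left volume (1 : ℝ)).prod (MeasurePreserving.id volume)

/-- The central reflection of the unit square preserves Lebesgue measure on the plane. -/
lemma measurePreserving_reflect :
    MeasurePreserving (fun p : ℝ × ℝ => (1 - p.1, 1 - p.2)) volume volume :=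
  (Measure.measurePreserving_sub_left volume (1 : ℝ)).prod
    (Measure.measurePreserving_sub_left volume (1 : ℝ))

lemma measurableEmbedding_reflect :
    MeasurableEmbedding (fun p : ℝ × ℝ => (1 - p.1, 1 - p.2)) :=
  ((MeasurableEquiv.subLeft (1 : ℝ)).prodCongr (MeasurableEquiv.subLeft (1 : ℝ))).measurableEmbedding

lemma ae_coord_ne (a : ℝ) : ∀ᵐ p : ℝ × ℝ, p.1 ≠ a ∧ p.2 ≠ a := by
  have h : ∀ᵐ x : ℝ, x ≠ a := Measure.ae_ne volume a
  exact (Measure.quasiMeasurePreserving_fst.ae h).and (Measure.quasiMeasurePreserving_snd.ae h)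

theorem stmt11 (c : ℝ × ℝ → ℝ)
    (sq : Set (ℝ × ℝ)) (hsq : sq = Set.Icc (0 : ℝ) 1 ×ˢ Set.Icc (0 : ℝ) 1)
    (hc : ∀ p, 0 ≤ c p)
    (hci : IntegrableOn c sq)
    (hsym : ∀ᵐ p ∂(volume.restrict sq), c p = c (1 - p.1, 1 - p.2))
    (hlower : ∀ᵐ p ∂(volume.restrict ((Set.Ioo (0 : ℝ) (1 / 2)) ×ˢ (Set.Ioo (0 : ℝ) (1 / 2)))),
        c (p.1, 1 - p.2) < c p) :
    ∫ p in sq, (if c (p.1, 1 - p.2) < c p then c p else 0)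
      = 2 * ∫ p in (Set.Icc (0 : ℝ) (1 / 2)) ×ˢ (Set.Icc (0 : ℝ) (1 / 2)), c p := by
  subst hsq
  have hsqm : MeasurableSet (Set.Icc (0 : ℝ) 1 ×ˢ Set.Icc (0 : ℝ) 1) :=
    measurableSet_Icc.prod measurableSet_Icc
  set A : Set (ℝ × ℝ) := Set.Icc (0 : ℝ) (1 / 2) ×ˢ Set.Icc (0 : ℝ) (1 / 2) with hA
  set B : Set (ℝ × ℝ) := Set.Icc (1 / 2 : ℝ) 1 ×ˢ Set.Icc (1 / 2 : ℝ) 1 with hB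
  have hAm : MeasurableSet A := measurableSet_Icc.prod measurableSet_Icc
  have hBm : MeasurableSet B := measurableSet_Icc.prod measurableSet_Icc
  have hAi : Integrable (A.indicator c) :=
    (hci.mono_set (Set.prod_mono (Set.Icc_subset_Icc le_rfl (by norm_num))
      (Set.Icc_subset_Icc le_rfl (by norm_num)))).integrable_indicator hAm
  have hBi : Integrable (B.indicator c) :=
    (hci.mono_set (Set.prod_mono (Set.Icc_subset_Icc (by norm_num) le_rfl)
      (Set.Icc_subset_Icc (by norm_num) le_rfl))).integrable_indicator hBm
  rw [ae_restrict_iff' hsqm] at hsym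
  rw [ae_restrict_iff' (measurableSet_Ioo.prod measurableSet_Ioo)] at hlower
  simp only [Set.mem_prod, Set.mem_Icc, Set.mem_Ioo] at hsym hlower
  have hBA : ∫ p, B.indicator c p = ∫ p, A.indicator c p := by
    rw [← measurePreserving_reflect.integral_comp measurableEmbedding_reflect (A.indicator c)]
    refine integral_congr_ae ?_
    filter_upwards [hsym] with p hp
    have hmem : (1 - p.1, 1 - p.2) ∈ A ↔ p ∈ B := by
      simp only [hA, hB, Set.mem_prod, Set.mem_Icc]
      constructor <;> rintro ⟨⟨_, _⟩, _, _⟩ <;> refine ⟨⟨?_, ?_⟩, ?_, ?_⟩ <;> linarith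
    by_cases h : p ∈ B
    · rw [Set.indicator_of_mem h, Set.indicator_of_mem (hmem.2 h)]
      obtain ⟨⟨_, _⟩, _, _⟩ := h
      exact hp ⟨⟨by linarith, by linarith⟩, by linarith, by linarith⟩
    · rw [Set.indicator_of_notMem h, Set.indicator_of_notMem (mt hmem.1 h)]
  rw [← integral_indicator hsqm, ← integral_indicator hAm, two_mul]
  nth_rw 2 [← hBA]
  rw [← integral_add hAi hBi]
  refine integral_congr_ae ?_
  filter_upwards [ae_coord_ne 0, ae_coord_ne (1 / 2), ae_coord_ne 1, hsym, hlower,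
    measurePreserving_reflect_snd.quasiMeasurePreserving.ae hsym,
    measurePreserving_reflect_snd.quasiMeasurePreserving.ae hlower,
    measurePreserving_reflect_fst.quasiMeasurePreserving.ae hlower,
    measurePreserving_reflect.quasiMeasurePreserving.ae hlower]
    with ⟨x, y⟩ h0 hh h1 hs hl hs₂ hl₂ hl₁ hl₁₂
  simp only [sub_sub_cancel] at h0 hh h1 hs hl hs₂ hl₂ hl₁ hl₁₂
  simp only [Set.indicator_apply, hA, hB, Set.mem_prod, Set.mem_Icc]
  by_cases hsq : (0 ≤ x ∧ x ≤ 1) ∧ 0 ≤ y ∧ y ≤ 1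
  · rw [if_pos hsq]
    obtain ⟨⟨hx0, hx1⟩, hy0, hy1⟩ := hsq
    have hx0 := hx0.lt_of_ne' h0.1
    have hy0 := hy0.lt_of_ne' h0.2
    have hx1 := hx1.lt_of_ne h1.1
    have hy1 := hy1.lt_of_ne h1.2
    have hs := hs ⟨⟨hx0.le, hx1.le⟩, hy0.le, hy1.le⟩
    have hs₂ := hs₂ ⟨⟨hx0.le, hx1.le⟩, by linarith, by linarith⟩
    rcases lt_or_gt_of_ne hh.1 with hx | hx <;> rcases lt_or_gt_of_ne hh.2 with hy | hy
    · have := hl ⟨⟨hx0, hx⟩, hy0, hy⟩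
      rw [if_pos this, if_pos ⟨⟨hx0.le, hx.le⟩, hy0.le, hy.le⟩,
        if_neg (fun h => absurd h.1.1 hx.not_ge), add_zero]
    · have := hl₂ ⟨⟨hx0, hx⟩, by linarith, by linarith⟩
      rw [if_neg this.not_gt, if_neg (fun h => absurd h.2.2 hy.not_ge),
        if_neg (fun h => absurd h.1.1 hx.not_ge), add_zero]
    · have := hl₁ ⟨⟨by linarith, by linarith⟩, hy0, hy⟩
      rw [← hs, ← hs₂] at this
      rw [if_neg this.not_gt, if_neg (fun h => absurd h.1.2 hx.not_ge),
        if_neg (fun h => absurd h.2.1 hy.not_ge), add_zero]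
    · have := hl₁₂ ⟨⟨by linarith, by linarith⟩, by linarith, by linarith⟩
      rw [← hs, ← hs₂] at this
      rw [if_pos this, if_neg (fun h => absurd h.1.2 hx.not_ge),
        if_pos ⟨⟨hx.le, hx1.le⟩, hy.le, hy1.le⟩, zero_add]
  · rw [if_neg hsq, if_neg, if_neg, add_zero]
    · rintro ⟨⟨_, _⟩, _, _⟩
      exact hsq ⟨⟨by linarith, by linarith⟩, by linarith, by linarith⟩
    · rintro ⟨⟨_, _⟩, _, _⟩
      exact hsq ⟨⟨by linarith, by linarith⟩, by linarith, by linarith⟩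
end

section
/- Let θ > 0 and define the Frank copula density c_θ(u,v) = θ·(1 − exp(−θ))·exp(−θ(u+v)) / [(1 − exp(−θ)) − (1 − exp(−θu))·(1 − exp(−θv))]^2 for (u,v) ∈ [0,1]^2. Then ∫_{[0,1]^2} 1{c_θ(u,v) > c_θ(u, 1−v)}·c_θ(u,v) du dv = 1/2 + (2/θ)·log(cosh(θ/4)); equivalently, 1 − ∫_{[0,1]^2} 1{c_θ(u,v) > c_θ(u, 1−v)}·c_θ(u,v) du dv = 1/2 − (2/θ)·log(cosh(θ/4)). -/
open MeasureTheory

/-- The density of the Frank copula with parameter `θ`. -/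
noncomputable def frankDens (θ u v : ℝ) : ℝ :=
  θ * (1 - Real.exp (-θ)) * Real.exp (-θ * (u + v)) /
    ((1 - Real.exp (-θ)) - (1 - Real.exp (-θ * u)) * (1 - Real.exp (-θ * v))) ^ 2

/-- The denominator of the Frank density, before squaring. -/
noncomputable def frankDenom (θ u v : ℝ) : ℝ :=
  (1 - Real.exp (-θ)) - (1 - Real.exp (-θ * u)) * (1 - Real.exp (-θ * v))

/-- The Frank copula with parameter `θ`, up to the normalizing constant in the logarithm. -/
noncomputable def frankPotential (θ u v : ℝ) : ℝ :=
  -(1 / θ) * Real.log (frankDenom θ u v)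

/-- The partial derivative of the Frank copula in its first argument. -/
noncomputable def frankPartial (θ u v : ℝ) : ℝ :=
  Real.exp (-θ * u) * (1 - Real.exp (-θ * v)) / frankDenom θ u v

lemma frankDenom_pos {θ u v : ℝ} (hθ : 0 < θ) (hu : u ∈ Set.Icc (0 : ℝ) 1)
    (hv : v ∈ Set.Icc (0 : ℝ) 1) : 0 < frankDenom θ u v := by
  have hE : Real.exp (-θ) < 1 := Real.exp_lt_one_iff.2 (by linarith)
  have ha : Real.exp (-θ) ≤ Real.exp (-θ * u) := Real.exp_le_exp.2 (by nlinarith [hu.2])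
  have hb : 0 < Real.exp (-θ * v) := Real.exp_pos _
  have hb1 : Real.exp (-θ * v) ≤ 1 := Real.exp_le_one_iff.2 (by nlinarith [hv.1])
  unfold frankDenom
  nlinarith [mul_nonneg (sub_nonneg.2 ha) (sub_nonneg.2 hb1), mul_pos hb (sub_pos.2 hE)]

lemma hasDerivAt_exp_neg_mul (θ x : ℝ) :
    HasDerivAt (fun t => Real.exp (-θ * t)) (-θ * Real.exp (-θ * x)) x := by
  have h := ((hasDerivAt_id x).const_mul (-θ)).exp
  exact h.congr_deriv (by simp [mul_comm])

lemma hasDerivAt_frankPotential {θ u v : ℝ} (hθ : 0 < θ) (hD : frankDenom θ u v ≠ 0) :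
    HasDerivAt (fun x => frankPotential θ x v) (frankPartial θ u v) u := by
  have h := ((((hasDerivAt_exp_neg_mul θ u).const_sub 1).mul_const
    (1 - Real.exp (-θ * v))).const_sub (1 - Real.exp (-θ))).log hD
  refine (h.const_mul (-(1 / θ))).congr_deriv ?_
  symm
  change frankPartial θ u v = -(1 / θ) * (_ / frankDenom θ u v)
  unfold frankPartial
  field_simp

lemma hasDerivAt_frankPartial {θ u v : ℝ} (hD : frankDenom θ u v ≠ 0) :
    HasDerivAt (frankPartial θ u) (frankDens θ u v) v := by
  have h := (hasDerivAt_exp_neg_mul θ v).const_sub 1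
  have h2 := (h.const_mul (Real.exp (-θ * u))).div
    ((h.const_mul (1 - Real.exp (-θ * u))).const_sub (1 - Real.exp (-θ))) hD
  refine h2.congr_deriv ?_
  symm
  change θ * _ * _ / frankDenom θ u v ^ 2 = _ / frankDenom θ u v ^ 2
  congr 1
  rw [mul_add, Real.exp_add]
  ring

lemma continuousOn_frankDens {θ : ℝ} (hθ : 0 < θ) :
    ContinuousOn (fun p : ℝ × ℝ => frankDens θ p.1 p.2)
      (Set.Icc (0 : ℝ) 1 ×ˢ Set.Icc (0 : ℝ) 1) := by
  unfold frankDens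
  refine ContinuousOn.div (by fun_prop) (by fun_prop) fun p hp => ?_
  exact pow_ne_zero 2 (frankDenom_pos hθ hp.1 hp.2).ne'

lemma integrableOn_frankDens {θ : ℝ} (hθ : 0 < θ) :
    IntegrableOn (fun p : ℝ × ℝ => frankDens θ p.1 p.2)
      (Set.Icc (0 : ℝ) 1 ×ˢ Set.Icc (0 : ℝ) 1) :=
  (continuousOn_frankDens hθ).integrableOn_compact (isCompact_Icc.prod isCompact_Icc)

lemma intervalIntegral_frankDens {θ u c d : ℝ} (hθ : 0 < θ) (hu : u ∈ Set.Icc (0 : ℝ) 1)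
    (hc : 0 ≤ c) (hcd : c ≤ d) (hd : d ≤ 1) :
    ∫ v in c..d, frankDens θ u v = frankPartial θ u d - frankPartial θ u c := by
  have hsub : Set.uIcc c d ⊆ Set.Icc 0 1 := by
    rw [Set.uIcc_of_le hcd]; exact Set.Icc_subset_Icc hc hd
  refine intervalIntegral.integral_eq_sub_of_hasDerivAt
    (fun v hv => hasDerivAt_frankPartial (frankDenom_pos hθ hu (hsub hv)).ne')
    (ContinuousOn.intervalIntegrable ?_)
  exact (continuousOn_frankDens hθ).comp (f := fun v => (u, v)) (by fun_prop)
    fun v hv => ⟨hu, hsub hv⟩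

lemma intervalIntegrable_frankPartial {θ v a b : ℝ} (hθ : 0 < θ) (hv : v ∈ Set.Icc (0 : ℝ) 1)
    (ha : 0 ≤ a) (hab : a ≤ b) (hb : b ≤ 1) :
    IntervalIntegrable (fun u => frankPartial θ u v) volume a b := by
  apply ContinuousOn.intervalIntegrable
  rw [Set.uIcc_of_le hab]
  refine ContinuousOn.div (by fun_prop) (by unfold frankDenom; fun_prop) fun u hu => ?_
  exact (frankDenom_pos hθ (Set.Icc_subset_Icc ha hb hu) hv).ne'

lemma intervalIntegral_frankPartial {θ v a b : ℝ} (hθ : 0 < θ) (hv : v ∈ Set.Icc (0 : ℝ) 1)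
    (ha : 0 ≤ a) (hab : a ≤ b) (hb : b ≤ 1) :
    ∫ u in a..b, frankPartial θ u v = frankPotential θ b v - frankPotential θ a v := by
  refine intervalIntegral.integral_eq_sub_of_hasDerivAt (f := fun u => frankPotential θ u v)
    (fun u hu => hasDerivAt_frankPotential hθ (frankDenom_pos hθ ?_ hv).ne')
    (intervalIntegrable_frankPartial hθ hv ha hab hb)
  rw [Set.uIcc_of_le hab] at hu
  exact Set.Icc_subset_Icc ha hb hu

lemma setIntegral_frankDens {θ a b c d : ℝ} (hθ : 0 < θ) (ha : 0 ≤ a) (hab : a ≤ b) (hb : b ≤ 1)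
    (hc : 0 ≤ c) (hcd : c ≤ d) (hd : d ≤ 1) :
    ∫ p in Set.Icc a b ×ˢ Set.Icc c d, frankDens θ p.1 p.2 =
      (frankPotential θ b d - frankPotential θ a d) -
        (frankPotential θ b c - frankPotential θ a c) := by
  have hint : IntegrableOn (fun p : ℝ × ℝ => frankDens θ p.1 p.2)
      (Set.Icc a b ×ˢ Set.Icc c d) (volume.prod volume) :=
    (integrableOn_frankDens hθ).mono_set
      (Set.prod_mono (Set.Icc_subset_Icc ha hb) (Set.Icc_subset_Icc hc hd))
  rw [Measure.volume_eq_prod, setIntegral_prod _ hint]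
  have hinner : ∀ u ∈ Set.Icc a b,
      ∫ v in Set.Icc c d, frankDens θ u v = frankPartial θ u d - frankPartial θ u c := by
    intro u hu
    rw [integral_Icc_eq_integral_Ioc, ← intervalIntegral.integral_of_le hcd]
    exact intervalIntegral_frankDens hθ (Set.Icc_subset_Icc ha hb hu) hc hcd hd
  have hd' : d ∈ Set.Icc (0 : ℝ) 1 := ⟨hc.trans hcd, hd⟩
  have hc' : c ∈ Set.Icc (0 : ℝ) 1 := ⟨hc, hcd.trans hd⟩
  rw [setIntegral_congr_fun measurableSet_Icc hinner, integral_Icc_eq_integral_Ioc,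
    ← intervalIntegral.integral_of_le hab,
    intervalIntegral.integral_sub (intervalIntegrable_frankPartial hθ hd' ha hab hb)
      (intervalIntegrable_frankPartial hθ hc' ha hab hb),
    intervalIntegral_frankPartial hθ hd' ha hab hb,
    intervalIntegral_frankPartial hθ hc' ha hab hb]

/-- The Frank density exceeds its reflection exactly on the two diagonal quarter squares. -/
lemma frankDens_reflect_lt_iff {θ u v : ℝ} (hθ : 0 < θ) (hu : u ∈ Set.Icc (0 : ℝ) 1)
    (hv : v ∈ Set.Icc (0 : ℝ) 1) :
    frankDens θ u (1 - v) < frankDens θ u v ↔ 0 < (u - 1 / 2) * (v - 1 / 2) := by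
  have hv' : 1 - v ∈ Set.Icc (0 : ℝ) 1 := ⟨by linarith [hv.2], by linarith [hv.1]⟩
  have hD := frankDenom_pos hθ hu hv
  have hD' := frankDenom_pos hθ hu hv'
  obtain ⟨e, he⟩ : ∃ e, e = Real.exp (-θ / 2) := ⟨_, rfl⟩
  obtain ⟨a, ha⟩ : ∃ a, a = Real.exp (-θ * u) := ⟨_, rfl⟩
  obtain ⟨s, hs⟩ : ∃ s, s = Real.exp (-θ * v / 2) := ⟨_, rfl⟩
  obtain ⟨t, ht⟩ : ∃ t, t = Real.exp (-θ * (1 - v) / 2) := ⟨_, rfl⟩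
  have hE : Real.exp (-θ) = e ^ 2 := by rw [he, ← Real.exp_nat_mul]; congr 1; push_cast; ring
  have hss : Real.exp (-θ * v) = s ^ 2 := by
    rw [hs, ← Real.exp_nat_mul]; congr 1; push_cast; ring
  have htt : Real.exp (-θ * (1 - v)) = t ^ 2 := by
    rw [ht, ← Real.exp_nat_mul]; congr 1; push_cast; ring
  have hst : s * t = e := by rw [hs, ht, he, ← Real.exp_add]; congr 1; ring
  have hs0 : 0 < s := hs ▸ Real.exp_pos _
  have ht0 : 0 < t := ht ▸ Real.exp_pos _
  have ha0 : 0 < a := ha ▸ Real.exp_pos _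
  have hk : 0 < θ * (1 - e ^ 2) * a := by
    have : Real.exp (-θ) < 1 := Real.exp_lt_one_iff.2 (by linarith)
    rw [hE] at this
    exact mul_pos (mul_pos hθ (by linarith)) ha0
  have key : frankDens θ u (1 - v) < frankDens θ u v ↔ 0 < (a - e) * (s - t) := by
    have e1 : frankDens θ u v = θ * (1 - e ^ 2) * a * (s / frankDenom θ u v) ^ 2 := by
      unfold frankDens
      rw [mul_add, Real.exp_add, hss, hE, ← ha]
      unfold frankDenom
      rw [hss, hE, ← ha, div_pow]
      ring
    have e2 : frankDens θ u (1 - v) =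
        θ * (1 - e ^ 2) * a * (t / frankDenom θ u (1 - v)) ^ 2 := by
      unfold frankDens
      rw [mul_add, Real.exp_add, htt, hE, ← ha]
      unfold frankDenom
      rw [htt, hE, ← ha, div_pow]
      ring
    have hid : s * frankDenom θ u (1 - v) - t * frankDenom θ u v =
        (1 + e) * ((a - e) * (s - t)) := by
      unfold frankDenom
      rw [hss, htt, hE, ← ha, ← hst]
      ring
    have he0 : 0 < 1 + e := by rw [← hst]; positivity
    rw [e1, e2, mul_lt_mul_iff_right₀ hk, pow_lt_pow_iff_left₀ (by positivity) (by positivity)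
      two_ne_zero, div_lt_div_iff₀ hD' hD, ← sub_pos, hid, mul_pos_iff_of_pos_left he0]
  have hae : a < e ↔ 1 / 2 < u := by
    rw [ha, he, Real.exp_lt_exp]; constructor <;> intro h <;> nlinarith
  have hea : e < a ↔ u < 1 / 2 := by
    rw [ha, he, Real.exp_lt_exp]; constructor <;> intro h <;> nlinarith
  have hst' : s < t ↔ 1 / 2 < v := by
    rw [hs, ht, Real.exp_lt_exp]; constructor <;> intro h <;> nlinarith
  have hts : t < s ↔ v < 1 / 2 := by
    rw [hs, ht, Real.exp_lt_exp]; constructor <;> intro h <;> nlinarith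
  rw [key, mul_pos_iff, mul_pos_iff]
  simp only [sub_pos, sub_neg, hae, hea, hst', hts]
  tauto

lemma unitSquare_inter_setOf_mul_pos :
    (Set.Icc (0 : ℝ) 1 ×ˢ Set.Icc (0 : ℝ) 1) ∩
        {p : ℝ × ℝ | 0 < (p.1 - 1 / 2) * (p.2 - 1 / 2)} =
      (Set.Ico (0 : ℝ) (1 / 2) ×ˢ Set.Ico (0 : ℝ) (1 / 2)) ∪
        (Set.Ioc (1 / 2 : ℝ) 1 ×ˢ Set.Ioc (1 / 2 : ℝ) 1) := by
  ext ⟨u, v⟩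
  simp only [Set.mem_inter_iff, Set.mem_prod, Set.mem_Icc, Set.mem_ofPred_eq, Set.mem_union,
    Set.mem_Ico, Set.mem_Ioc, mul_pos_iff, sub_pos, sub_neg]
  constructor
  · rintro ⟨⟨⟨_, _⟩, _, _⟩, ⟨_, _⟩ | ⟨_, _⟩⟩
    · right; refine ⟨⟨?_, ?_⟩, ?_, ?_⟩ <;> assumption
    · left; refine ⟨⟨?_, ?_⟩, ?_, ?_⟩ <;> assumption
  · rintro (⟨⟨_, _⟩, _, _⟩ | ⟨⟨_, _⟩, _, _⟩)
    · exact ⟨⟨⟨by linarith, by linarith⟩, by linarith, by linarith⟩,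
        Or.inr ⟨by linarith, by linarith⟩⟩
    · exact ⟨⟨⟨by linarith, by linarith⟩, by linarith, by linarith⟩,
        Or.inl ⟨by linarith, by linarith⟩⟩

lemma frankPotential_quarter_squares {θ : ℝ} (hθ : 0 < θ) :
    ((frankPotential θ (1 / 2) (1 / 2) - frankPotential θ 0 (1 / 2)) -
        (frankPotential θ (1 / 2) 0 - frankPotential θ 0 0)) +
      ((frankPotential θ 1 1 - frankPotential θ (1 / 2) 1) -
        (frankPotential θ 1 (1 / 2) - frankPotential θ (1 / 2) (1 / 2))) =
      1 / 2 + (2 / θ) * Real.log (Real.cosh (θ / 4)) := by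
  obtain ⟨r, hr⟩ : ∃ r, r = Real.exp (-θ / 4) := ⟨_, rfl⟩
  have hr0 : 0 < r := hr ▸ Real.exp_pos _
  have hr1 : r < 1 := hr ▸ Real.exp_lt_one_iff.2 (by linarith)
  have h1 : Real.exp (-θ) = r ^ 4 := by rw [hr, ← Real.exp_nat_mul]; congr 1; push_cast; ring
  have h2 : Real.exp (-θ * (1 / 2)) = r ^ 2 := by
    rw [hr, ← Real.exp_nat_mul]; congr 1; push_cast; ring
  have hlr : Real.log r = -θ / 4 := by rw [hr, Real.log_exp]
  have hcosh : Real.cosh (θ / 4) = (1 + r ^ 2) / (2 * r) := by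
    have : Real.exp (θ / 4) = r⁻¹ := by rw [hr, ← Real.exp_neg]; congr 1; ring
    rw [Real.cosh_eq, this, ← neg_div, ← hr]
    field_simp
  have hm : 0 < 1 - r ^ 2 := by nlinarith
  have hp : 0 < 1 + r ^ 2 := by positivity
  have d1 : frankDenom θ (1 / 2) (1 / 2) = 2 * (r ^ 2 * (1 - r ^ 2)) := by
    unfold frankDenom; rw [h1, h2]; ring
  have d2 : frankDenom θ 0 (1 / 2) = (1 - r ^ 2) * (1 + r ^ 2) := by
    unfold frankDenom; rw [h1]; simp; ring
  have d3 : frankDenom θ (1 / 2) 0 = (1 - r ^ 2) * (1 + r ^ 2) := by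
    unfold frankDenom; rw [h1]; simp; ring
  have d4 : frankDenom θ 0 0 = (1 - r ^ 2) * (1 + r ^ 2) := by
    unfold frankDenom; rw [h1]; simp; ring
  have d5 : frankDenom θ 1 1 = r ^ 4 * ((1 - r ^ 2) * (1 + r ^ 2)) := by
    unfold frankDenom; rw [mul_one, h1]; ring
  have d6 : frankDenom θ (1 / 2) 1 = r ^ 2 * ((1 - r ^ 2) * (1 + r ^ 2)) := by
    unfold frankDenom; rw [mul_one, h1, h2]; ring
  have d7 : frankDenom θ 1 (1 / 2) = r ^ 2 * ((1 - r ^ 2) * (1 + r ^ 2)) := by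
    unfold frankDenom; rw [mul_one, h1, h2]; ring
  simp only [frankPotential, d1, d2, d3, d4, d5, d6, d7, hcosh]
  rw [Real.log_div hp.ne' (by positivity)]
  repeat rw [Real.log_mul (by positivity) (by positivity)]
  simp only [Real.log_pow, hlr]
  push_cast
  field_simp
  ring

lemma setIntegral_frankDens_reflect_lt {θ : ℝ} (hθ : 0 < θ) :
    ∫ p in Set.Icc (0 : ℝ) 1 ×ˢ Set.Icc (0 : ℝ) 1,
        (if frankDens θ p.1 (1 - p.2) < frankDens θ p.1 p.2 then frankDens θ p.1 p.2 else 0) =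
      1 / 2 + (2 / θ) * Real.log (Real.cosh (θ / 4)) := by
  have hmeas : MeasurableSet {p : ℝ × ℝ | 0 < (p.1 - 1 / 2) * (p.2 - 1 / 2)} :=
    measurableSet_lt (by fun_prop) (by fun_prop)
  have hcongr : Set.EqOn
      (fun p : ℝ × ℝ =>
        if frankDens θ p.1 (1 - p.2) < frankDens θ p.1 p.2 then frankDens θ p.1 p.2 else 0)
      ({p : ℝ × ℝ | 0 < (p.1 - 1 / 2) * (p.2 - 1 / 2)}.indicator
        fun p => frankDens θ p.1 p.2) (Set.Icc (0 : ℝ) 1 ×ˢ Set.Icc (0 : ℝ) 1) := by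
    intro p hp
    simp only [Set.indicator_apply, Set.mem_ofPred_eq, frankDens_reflect_lt_iff hθ hp.1 hp.2]
  have hdisj : Disjoint (Set.Ico (0 : ℝ) (1 / 2) ×ˢ Set.Ico (0 : ℝ) (1 / 2))
      (Set.Ioc (1 / 2 : ℝ) 1 ×ˢ Set.Ioc (1 / 2 : ℝ) 1) :=
    Set.disjoint_left.2 fun p hp hq => lt_asymm hp.1.2 hq.1.1
  have hlow : (Set.Ico (0 : ℝ) (1 / 2) ×ˢ Set.Ico (0 : ℝ) (1 / 2) : Set (ℝ × ℝ)) =ᵐ[volume]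
      (Set.Icc (0 : ℝ) (1 / 2) ×ˢ Set.Icc (0 : ℝ) (1 / 2) : Set (ℝ × ℝ)) :=
    Measure.set_prod_ae_eq Ico_ae_eq_Icc Ico_ae_eq_Icc
  have hhigh : (Set.Ioc (1 / 2 : ℝ) 1 ×ˢ Set.Ioc (1 / 2 : ℝ) 1 : Set (ℝ × ℝ)) =ᵐ[volume]
      (Set.Icc (1 / 2 : ℝ) 1 ×ˢ Set.Icc (1 / 2 : ℝ) 1 : Set (ℝ × ℝ)) :=
    Measure.set_prod_ae_eq Ioc_ae_eq_Icc Ioc_ae_eq_Icc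
  have hsub := unitSquare_inter_setOf_mul_pos.symm.subset.trans Set.inter_subset_left
  rw [setIntegral_congr_fun (measurableSet_Icc.prod measurableSet_Icc) hcongr,
    setIntegral_indicator hmeas, unitSquare_inter_setOf_mul_pos,
    setIntegral_union hdisj (measurableSet_Ioc.prod measurableSet_Ioc)
      ((integrableOn_frankDens hθ).mono_set (Set.subset_union_left.trans hsub))
      ((integrableOn_frankDens hθ).mono_set (Set.subset_union_right.trans hsub)),
    setIntegral_congr_set hlow, setIntegral_congr_set hhigh,
    setIntegral_frankDens hθ (by norm_num) (by norm_num) (by norm_num) (by norm_num)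
      (by norm_num) (by norm_num),
    setIntegral_frankDens hθ (by norm_num) (by norm_num) (by norm_num) (by norm_num)
      (by norm_num) (by norm_num)]
  exact frankPotential_quarter_squares hθ

theorem stmt14 (θ : ℝ) (hθ : 0 < θ) :
    (∫ p in (Set.Icc (0 : ℝ) 1 ×ˢ Set.Icc (0 : ℝ) 1),
        (if frankDens θ p.1 (1 - p.2) < frankDens θ p.1 p.2 then frankDens θ p.1 p.2 else 0))
      = 1 / 2 + (2 / θ) * Real.log (Real.cosh (θ / 4)) ∧
    1 - (∫ p in (Set.Icc (0 : ℝ) 1 ×ˢ Set.Icc (0 : ℝ) 1),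
        (if frankDens θ p.1 (1 - p.2) < frankDens θ p.1 p.2 then frankDens θ p.1 p.2 else 0))
      = 1 / 2 - (2 / θ) * Real.log (Real.cosh (θ / 4)) := by
  refine ⟨setIntegral_frankDens_reflect_lt hθ, ?_⟩
  rw [setIntegral_frankDens_reflect_lt hθ]
  ring
end
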